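/- Let G be 3-edge-connected with DFS tree T rooted at r, let v ≠ r be a vertex with m = M̃(v) defined, and suppose u is the minimum vertex in M⁻¹(m) strictly greater than v. Then there exists a back-edge e such that B(v) = B(u) ⊔ {e} if and only if: b_count(v) = b_count(u) + 1, l2(M(v)) ≥ v, and either M(v) has no low2 child or low1(c_2(M(v))) ≥ v. -/

import Mathlib

/-- An undirected multigraph `G` (parallel edges allowed, no self-loops) together with a
DFS spanning tree `T` rooted at `root`, where the vertices are identified with their DFS
preorder numbers (so they are `Fin n`, and the root gets the smallest number).
Tree edges are oriented from child to parent and back-edges from descendant to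
(proper) ancestor. -/
structure DFSGraph where
  /-- number of vertices; the vertices are `Fin n`, numbered in DFS preorder -/
  n : ℕ
  /-- the type indexing the edges (parallel edges are allowed) -/
  Edge : Type
  edgeFintype : Fintype Edge
  /-- the first endpoint (the descendant end) of each edge -/
  fst : Edge → Fin n
  /-- the second endpoint (the ancestor end) of each edge -/
  snd : Edge → Fin n
  /-- no self-loops -/
  noloop : ∀ e, fst e ≠ snd e
  /-- the root `r` of the DFS tree -/
  root : Fin n
  /-- in DFS preorder the root gets the smallest number -/
  root_le : ∀ v, root ≤ v
  /-- the parent function `p` of the DFS tree (arbitrary at the root) -/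
  parent : Fin n → Fin n
  /-- the parent of a non-root vertex precedes it in preorder -/
  parent_lt : ∀ v, v ≠ root → parent v < v
  /-- `tEdge v` is the tree edge `(v, p(v))`, for `v ≠ root` -/
  tEdge : Fin n → Edge
  tEdge_fst : ∀ v, v ≠ root → fst (tEdge v) = v
  tEdge_snd : ∀ v, v ≠ root → snd (tEdge v) = parent v
  tEdge_inj : ∀ u v, u ≠ root → v ≠ root → tEdge u = tEdge v → u = v
  /-- DFS property: every non-tree edge is a back-edge, i.e. it joins a vertex to an
  ancestor of it (a proper ancestor, by `noloop`) -/
  back_anc : ∀ e, (¬ ∃ v, v ≠ root ∧ e = tEdge v) →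
    Relation.ReflTransGen (fun x y => x ≠ root ∧ y = parent x) (fst e) (snd e)
  /-- preorder property: the descendants of any vertex form an interval of preorder
  numbers starting at that vertex -/
  preorder_interval : ∀ v u w : Fin n, v ≤ u → u ≤ w →
    Relation.ReflTransGen (fun x y => x ≠ root ∧ y = parent x) w v →
    Relation.ReflTransGen (fun x y => x ≠ root ∧ y = parent x) u v

namespace DFSGraph

variable (G : DFSGraph)

/-- `Anc a b`: `a` is an ancestor of `b` in `T` (every vertex is an ancestor of itself). -/
def Anc (a b : Fin G.n) : Prop :=
  Relation.ReflTransGen (fun x y => x ≠ G.root ∧ y = G.parent x) b a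

/-- `PAnc a b`: `a` is a proper ancestor of `b` in `T`. -/
def PAnc (a b : Fin G.n) : Prop := G.Anc a b ∧ a ≠ b

/-- `e` is an edge of the spanning tree `T`. -/
def IsTreeEdge (e : G.Edge) : Prop := ∃ v, v ≠ G.root ∧ e = G.tEdge v

/-- `e` is a back-edge (an edge of `G ∖ T`). -/
def IsBack (e : G.Edge) : Prop := ¬ G.IsTreeEdge e

/-- `B v`: the set of back-edges `(x, y)` with `x` a descendant of `v` and `y` a proper
ancestor of `v`. -/
def B (v : Fin G.n) : Set G.Edge :=
  {e | G.IsBack e ∧ G.Anc v (G.fst e) ∧ G.PAnc (G.snd e) v}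

/-- `b_count(v) = |B(v)|`. -/
noncomputable def bcount (v : Fin G.n) : ℕ := (G.B v).ncard

/-- adjacency in `G` after removing the edge set `S` -/
def AdjOff (S : Set G.Edge) (x y : Fin G.n) : Prop :=
  ∃ e, e ∉ S ∧ ((G.fst e = x ∧ G.snd e = y) ∨ (G.fst e = y ∧ G.snd e = x))

/-- `G ∖ S` is connected -/
def ConnectedOff (S : Set G.Edge) : Prop :=
  ∀ x y, Relation.ReflTransGen (G.AdjOff S) x y

/-- `S` is an edge cut of `G`: removing `S` disconnects `G`. -/
def IsCut (S : Set G.Edge) : Prop := ¬ G.ConnectedOff S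

/-- `G` is `k`-edge-connected: it has no cut of fewer than `k` edges. -/
def EdgeConn (k : ℕ) : Prop := ∀ S : Set G.Edge, S.ncard < k → ¬ G.IsCut S

/-- `IsLow1 v y`: `y = low1(v) = min {y | ∃ (x,y) ∈ B(v)}`. -/
def IsLow1 (v y : Fin G.n) : Prop :=
  (∃ e ∈ G.B v, G.snd e = y) ∧ ∀ e ∈ G.B v, y ≤ G.snd e

/-- `IsHigh v y`: `y = high(v) = max {y | ∃ (x,y) ∈ B(v)}`. -/
def IsHigh (v y : Fin G.n) : Prop :=
  (∃ e ∈ G.B v, G.snd e = y) ∧ ∀ e ∈ G.B v, G.snd e ≤ y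

/-- `IsLow2 v y`: `y = low2(v)`, the minimum lower end of the back-edges in `B(v)` minus
one (fixed, but arbitrary) back-edge `(low1D(v), low1(v))` attaining `low1(v)`. -/
def IsLow2 (v y : Fin G.n) : Prop :=
  ∃ f ∈ G.B v, (∀ g ∈ G.B v, G.snd f ≤ G.snd g) ∧
    (∃ e ∈ G.B v, e ≠ f ∧ G.snd e = y) ∧
    (∀ e ∈ G.B v, e ≠ f → y ≤ G.snd e)

/-- `IsL1 v y`: `y = l1(v) = min ({y | (v,y) is a back-edge} ∪ {v})`. -/
def IsL1 (v y : Fin G.n) : Prop :=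
  (y = v ∨ ∃ e, G.IsBack e ∧ G.fst e = v ∧ G.snd e = y) ∧
  y ≤ v ∧ (∀ e, G.IsBack e → G.fst e = v → y ≤ G.snd e)

/-- `IsL2 v y`: `y = l2(v)`, defined as `l1(v)` but after removing one (fixed, but
arbitrary) back-edge `(v, l1(v))` attaining `l1(v)`, if such a back-edge exists. -/
def IsL2 (v y : Fin G.n) : Prop :=
  ((¬ ∃ e, G.IsBack e ∧ G.fst e = v) ∧ y = v) ∨
  (∃ f, G.IsBack f ∧ G.fst f = v ∧
    (∀ g, G.IsBack g → G.fst g = v → G.snd f ≤ G.snd g) ∧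
    (y = v ∨ ∃ e, G.IsBack e ∧ G.fst e = v ∧ e ≠ f ∧ G.snd e = y) ∧
    y ≤ v ∧
    (∀ e, G.IsBack e → G.fst e = v → e ≠ f → y ≤ G.snd e))

/-- `z` is the nearest common ancestor of the set of vertices `S`. -/
def IsNCA (S : Set (Fin G.n)) (z : Fin G.n) : Prop :=
  (∀ x ∈ S, G.Anc z x) ∧ ∀ z', (∀ x ∈ S, G.Anc z' x) → G.Anc z' z

/-- `IsM v m`: `m = M(v)`, the nearest common ancestor of all higher ends of back-edges
in `B(v)`. -/
def IsM (v m : Fin G.n) : Prop :=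
  G.IsNCA {x | ∃ e ∈ G.B v, G.fst e = x} m

/-- `IsMtilde v m`: `m = M̃(v)`, the nearest common ancestor of all higher ends of
back-edges in `B(v)` that are proper descendants of `M(v)` (defined only if such a
higher end exists). -/
def IsMtilde (v m : Fin G.n) : Prop :=
  ∃ mv, G.IsM v mv ∧
    {x | ∃ e ∈ G.B v, G.fst e = x ∧ G.PAnc mv x}.Nonempty ∧
    G.IsNCA {x | ∃ e ∈ G.B v, G.fst e = x ∧ G.PAnc mv x} m

/-- `c` is a child of `p` in `T`. -/
def IsChild (p c : Fin G.n) : Prop := c ≠ G.root ∧ G.parent c = p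

/-- `low1(c) ≤ low1(c')` (stated relationally). -/
def Low1LE (c c' : Fin G.n) : Prop :=
  ∀ y y', G.IsLow1 c y → G.IsLow1 c' y' → y ≤ y'

/-- `c = c₁(p)`: `c` is a `low1` child of `p`, i.e. a child of `p` minimizing `low1`. -/
def IsC1 (p c : Fin G.n) : Prop :=
  G.IsChild p c ∧ ∀ c', G.IsChild p c' → G.Low1LE c c'

/-- `c = c₂(p)`: `c` is a `low2` child of `p`, i.e. a child of `p` minimizing `low1`
among the children different from the (fixed) `low1` child. -/
def IsC2 (p c : Fin G.n) : Prop :=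
  ∃ c1, G.IsC1 p c1 ∧ G.IsChild p c ∧ c ≠ c1 ∧
    ∀ c', G.IsChild p c' → c' ≠ c1 → G.Low1LE c c'

/-- `c = c₃(p)`: `c` is a `low3` child of `p`. -/
def IsC3 (p c : Fin G.n) : Prop :=
  ∃ c1 c2, G.IsC1 p c1 ∧
    (G.IsChild p c2 ∧ c2 ≠ c1 ∧ ∀ c', G.IsChild p c' → c' ≠ c1 → G.Low1LE c2 c') ∧
    G.IsChild p c ∧ c ≠ c1 ∧ c ≠ c2 ∧
    (∀ c', G.IsChild p c' → c' ≠ c1 → c' ≠ c2 → G.Low1LE c c')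

/-- `IsMlow1 v m`: `m = M_low1(v)`, the nearest common ancestor of all higher ends of
back-edges in `B(v)` that are descendants of the `low1` child of `M(v)` (defined only
if such a higher end exists). -/
def IsMlow1 (v m : Fin G.n) : Prop :=
  ∃ mv c1, G.IsM v mv ∧ G.IsC1 mv c1 ∧
    {x | ∃ e ∈ G.B v, G.fst e = x ∧ G.Anc c1 x}.Nonempty ∧
    G.IsNCA {x | ∃ e ∈ G.B v, G.fst e = x ∧ G.Anc c1 x} m

/-- `IsMlow2 v m`: `m = M_low2(v)`, the nearest common ancestor of all higher ends of
back-edges in `B(v)` that are descendants of the `low2` child of `M(v)` (defined only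
if such a higher end exists). -/
def IsMlow2 (v m : Fin G.n) : Prop :=
  ∃ mv c2, G.IsM v mv ∧ G.IsC2 mv c2 ∧
    {x | ∃ e ∈ G.B v, G.fst e = x ∧ G.Anc c2 x}.Nonempty ∧
    G.IsNCA {x | ∃ e ∈ G.B v, G.fst e = x ∧ G.Anc c2 x} m

/-- `IsNextM v w`: `w = nextM(v)`, the maximum vertex `w < v` with `M(w) = M(v)`. -/
def IsNextM (v w : Fin G.n) : Prop :=
  ∃ m, G.IsM v m ∧ G.IsM w m ∧ w < v ∧ ∀ w', w' < v → G.IsM w' m → w' ≤ w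

/-- `IsLowM v l`: `l = low_M(v) = min {y | ∃ (x,y) ∈ B(v) ∖ B(nextM(v))}`. -/
def IsLowM (v l : Fin G.n) : Prop :=
  ∃ w, G.IsNextM v w ∧ (∃ e ∈ G.B v, e ∉ G.B w ∧ G.snd e = l) ∧
    ∀ e ∈ G.B v, e ∉ G.B w → l ≤ G.snd e

end DFSGraph

namespace DFSGraph

variable {G : DFSGraph}

lemma Anc.trans {a b c : Fin G.n} (h : G.Anc a b) (h' : G.Anc b c) : G.Anc a c :=
  Relation.ReflTransGen.trans h' h

lemma Anc.le {a b : Fin G.n} (h : G.Anc a b) : a ≤ b := by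
  unfold Anc at h
  induction h with
  | refl => exact le_rfl
  | tail _ hs ih =>
    obtain ⟨h1, rfl⟩ := hs
    exact (G.parent_lt _ h1).le.trans ih

lemma Anc.antisymm {a b : Fin G.n} (h : G.Anc a b) (h' : G.Anc b a) : a = b :=
  le_antisymm h.le h'.le

lemma PAnc.lt {a b : Fin G.n} (h : G.PAnc a b) : a < b := lt_of_le_of_ne h.1.le h.2

/-- Two ancestors of a common vertex are comparable, in the order given by their numbers. -/
lemma Anc.anc_of_le {a b x : Fin G.n} (ha : G.Anc a x) (hb : G.Anc b x) (hab : a ≤ b) :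
    G.Anc a b := by
  have hu : Relator.RightUnique (fun x y : Fin G.n => x ≠ G.root ∧ y = G.parent x) := by
    rintro p q r ⟨_, rfl⟩ ⟨_, rfl⟩
    rfl
  rcases Relation.ReflTransGen.total_of_right_unique hu ha hb with h | h
  · have : a = b := le_antisymm hab (Anc.le h)
    exact this ▸ Relation.ReflTransGen.refl
  · exact h

lemma Anc.panc_of_lt {a b x : Fin G.n} (ha : G.Anc a x) (hb : G.Anc b x) (hab : a < b) :
    G.PAnc a b := ⟨ha.anc_of_le hb hab.le, hab.ne⟩

lemma PAnc.trans_anc {a b c : Fin G.n} (h : G.PAnc a b) (h' : G.Anc b c) : G.PAnc a c :=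
  ⟨h.1.trans h', (h.lt.trans_le h'.le).ne⟩

lemma IsChild.anc {p c : Fin G.n} (h : G.IsChild p c) : G.Anc p c :=
  Relation.ReflTransGen.single ⟨h.1, h.2.symm⟩

lemma IsChild.lt {p c : Fin G.n} (h : G.IsChild p c) : p < c :=
  h.2 ▸ G.parent_lt c h.1

/-- The child of `p` on the tree path towards a proper descendant `x`. -/
lemma PAnc.exists_child {p x : Fin G.n} (h : G.PAnc p x) :
    ∃ c, G.IsChild p c ∧ G.Anc c x := by
  rcases Relation.ReflTransGen.cases_tail h.1 with h1 | ⟨c, h1, h2, h3⟩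
  · exact absurd h1 h.2
  · exact ⟨c, ⟨h2, h3.symm⟩, h1⟩

/-- A proper ancestor of `x` is an ancestor of the parent of `x`. -/
lemma PAnc.anc_parent {a x : Fin G.n} (h : G.PAnc a x) : G.Anc a (G.parent x) := by
  rcases Relation.ReflTransGen.cases_head h.1 with h1 | ⟨c, ⟨_, rfl⟩, h2⟩
  · exact absurd h1.symm h.2
  · exact h2

lemma IsChild.eq_of_anc {p c c' x : Fin G.n} (hc : G.IsChild p c) (hc' : G.IsChild p c')
    (h : G.Anc c x) (h' : G.Anc c' x) : c = c' := by
  rcases lt_trichotomy c c' with hl | hl | hl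
  · have := (h.panc_of_lt h' hl).anc_parent
    rw [hc'.2] at this
    exact absurd hc.lt this.le.not_gt
  · exact hl
  · have := (h'.panc_of_lt h hl).anc_parent
    rw [hc.2] at this
    exact absurd hc'.lt this.le.not_gt

lemma IsBack.anc {e : G.Edge} (h : G.IsBack e) : G.Anc (G.snd e) (G.fst e) :=
  G.back_anc e h

lemma mem_B_of_lt {e : G.Edge} {w : Fin G.n} (he : G.IsBack e) (hw : G.Anc w (G.fst e))
    (hl : G.snd e < w) : e ∈ G.B w :=
  ⟨he, hw, he.anc.panc_of_lt hw hl⟩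

lemma snd_lt_of_mem_B {e : G.Edge} {w : Fin G.n} (he : e ∈ G.B w) : G.snd e < w :=
  he.2.2.lt

/-- If `B w` is empty, the tree edge above `w` is a bridge. -/
lemma EdgeConn.B_nonempty (h3 : G.EdgeConn 3) {w : Fin G.n} (hw : w ≠ G.root) :
    (G.B w).Nonempty := by
  by_contra hB
  have hcon : G.ConnectedOff {G.tEdge w} := by
    have := h3 {G.tEdge w} (by simp)
    simpa [IsCut] using this
  have key : ∀ e, e ∉ ({G.tEdge w} : Set G.Edge) →
      (G.Anc w (G.fst e) ↔ G.Anc w (G.snd e)) := by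
    intro e he
    by_cases ht : G.IsTreeEdge e
    · obtain ⟨x, hx, rfl⟩ := ht
      have hxw : w ≠ x := by
        rintro rfl
        exact he rfl
      rw [G.tEdge_fst x hx, G.tEdge_snd x hx]
      exact ⟨fun h => PAnc.anc_parent ⟨h, hxw⟩,
        fun h => h.trans (IsChild.anc ⟨hx, rfl⟩)⟩
    · have hb : G.IsBack e := ht
      refine ⟨fun h => ?_, fun h => h.trans hb.anc⟩
      rcases lt_or_ge (G.snd e) w with hl | hl
      · exact absurd ⟨e, mem_B_of_lt hb h hl⟩ hB
      · exact h.anc_of_le hb.anc hl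
  have inv : ∀ x, Relation.ReflTransGen (G.AdjOff {G.tEdge w}) w x → G.Anc w x := by
    intro x hx
    induction hx with
    | refl => exact Relation.ReflTransGen.refl
    | tail _ hs ih =>
      obtain ⟨e, he, ⟨rfl, rfl⟩ | ⟨rfl, rfl⟩⟩ := hs
      · exact (key e he).1 ih
      · exact (key e he).2 ih
  exact hw (le_antisymm (inv _ (hcon w G.root)).le (G.root_le w))

instance (G : DFSGraph) : Finite G.Edge :=
  haveI := G.edgeFintype
  inferInstance

lemma EdgeConn.exists_isLow1 (h3 : G.EdgeConn 3) {w : Fin G.n} (hw : w ≠ G.root) :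
    ∃ y, G.IsLow1 w y := by
  obtain ⟨e, he, hmin⟩ :=
    Set.exists_min_image (G.B w) G.snd (Set.toFinite _) (h3.B_nonempty hw)
  exact ⟨G.snd e, ⟨e, he, rfl⟩, hmin⟩

lemma IsLow1.unique {w y y' : Fin G.n} (h : G.IsLow1 w y) (h' : G.IsLow1 w y') : y = y' := by
  obtain ⟨⟨e, he, rfl⟩, h2⟩ := h
  obtain ⟨⟨e', he', rfl⟩, h2'⟩ := h'
  exact le_antisymm (h2 _ he') (h2' _ he)

/-- A nonempty set of non-root vertices has a member of minimum `low1`. -/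
lemma EdgeConn.exists_low1LE (h3 : G.EdgeConn 3) {S : Set (Fin G.n)} (hS : S.Nonempty)
    (hr : ∀ c ∈ S, c ≠ G.root) : ∃ c ∈ S, ∀ c' ∈ S, G.Low1LE c c' := by
  have hex : ∀ w : Fin G.n, ∃ y, w ≠ G.root → G.IsLow1 w y := fun w => by
    by_cases hw : w = G.root
    · exact ⟨w, fun h => absurd hw h⟩
    · obtain ⟨y, hy⟩ := h3.exists_isLow1 hw
      exact ⟨y, fun _ => hy⟩
  choose low hlow using hex
  obtain ⟨c, hc, hmin⟩ := Set.exists_min_image S low (Set.toFinite _) hS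
  refine ⟨c, hc, fun c' hc' y y' hy hy' => ?_⟩
  rw [hy.unique (hlow c (hr c hc)), hy'.unique (hlow c' (hr c' hc'))]
  exact hmin c' hc'

/-- Among two distinct children, one has `low1` at least that of a `low2` child. -/
lemma EdgeConn.exists_isC2 (h3 : G.EdgeConn 3) {p c c' : Fin G.n} (hc : G.IsChild p c)
    (hc' : G.IsChild p c') (hne : c ≠ c') :
    ∃ c2, G.IsC2 p c2 ∧ (G.Low1LE c2 c ∨ G.Low1LE c2 c') := by
  obtain ⟨c1, hc1, hmin1⟩ := h3.exists_low1LE (S := {d | G.IsChild p d}) ⟨c, hc⟩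
    fun d hd => hd.1
  have hex : ∃ d, (d = c ∨ d = c') ∧ G.IsChild p d ∧ d ≠ c1 := by
    by_cases h : c = c1
    · exact ⟨c', Or.inr rfl, hc', fun h' => hne (h.trans h'.symm)⟩
    · exact ⟨c, Or.inl rfl, hc, h⟩
  obtain ⟨d, hd, hd'⟩ := hex
  obtain ⟨c2, hc2, hmin2⟩ := h3.exists_low1LE (S := {d | G.IsChild p d ∧ d ≠ c1}) ⟨d, hd'⟩
    fun d hd => hd.1.1
  refine ⟨c2, ⟨c1, ⟨hc1, hmin1⟩, hc2.1, hc2.2, fun x hx hx' => hmin2 x ⟨hx, hx'⟩⟩, ?_⟩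
  rcases hd with rfl | rfl
  · exact Or.inl (hmin2 _ hd')
  · exact Or.inr (hmin2 _ hd')

/-- Two distinct back-edges leaving `p` bound `l2 p` by the larger of their lower ends. -/
lemma exists_isL2_le {p : Fin G.n} {e e' : G.Edge} (he : G.IsBack e) (he' : G.IsBack e')
    (hp : G.fst e = p) (hp' : G.fst e' = p) (hne : e ≠ e') :
    ∃ y, G.IsL2 p y ∧ (y ≤ G.snd e ∨ y ≤ G.snd e') := by
  obtain ⟨f, hf, hminf⟩ := Set.exists_min_image {g | G.IsBack g ∧ G.fst g = p} G.snd
    (Set.toFinite _) ⟨e, he, hp⟩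
  have hex : ∃ d, (d = e ∨ d = e') ∧ (G.IsBack d ∧ G.fst d = p) ∧ d ≠ f := by
    by_cases h : e = f
    · exact ⟨e', Or.inr rfl, ⟨he', hp'⟩, fun h' => hne (h.trans h'.symm)⟩
    · exact ⟨e, Or.inl rfl, ⟨he, hp⟩, h⟩
  obtain ⟨d, hd, hd'⟩ := hex
  obtain ⟨g, hg, hming⟩ := Set.exists_min_image
    {g | (G.IsBack g ∧ G.fst g = p) ∧ g ≠ f} G.snd (Set.toFinite _) ⟨d, hd'⟩
  refine ⟨G.snd g, Or.inr ⟨f, hf.1, hf.2, fun x hx hx' => hminf x ⟨hx, hx'⟩,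
    Or.inr ⟨g, hg.1.1, hg.1.2, hg.2, rfl⟩, hg.1.2 ▸ hg.1.1.anc.le,
    fun x hx hx' hxf => hming x ⟨⟨hx, hx'⟩, hxf⟩⟩, ?_⟩
  rcases hd with rfl | rfl
  · exact Or.inl (hming _ hd')
  · exact Or.inr (hming _ hd')

lemma IsM.anc {v m : Fin G.n} (h : G.IsM v m) : G.Anc v m :=
  h.2 v (by rintro _ ⟨e, he, rfl⟩; exact he.2.1)

lemma IsM.anc_fst {v m : Fin G.n} (h : G.IsM v m) {e : G.Edge} (he : e ∈ G.B v) :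
    G.Anc m (G.fst e) := h.1 _ ⟨e, he, rfl⟩

lemma mem_B_of_isChild {v p c : Fin G.n} (hv : G.Anc v p) (hc : G.IsChild p c) {e : G.Edge}
    (he : e ∈ G.B v) (hce : G.Anc c (G.fst e)) : e ∈ G.B c :=
  ⟨he.1, hce, he.2.2.trans_anc (hv.trans hc.anc)⟩

lemma mem_B_of_isChild_of_lt {v p c : Fin G.n} (hv : G.Anc v p) (hc : G.IsChild p c)
    {e : G.Edge} (he : e ∈ G.B c) (hl : G.snd e < v) : e ∈ G.B v :=
  mem_B_of_lt he.1 ((hv.trans hc.anc).trans he.2.1) hl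

/-- If `B v` is `B u` together with one more edge, that edge leaves `M v`, and `M v` is a
proper ancestor of `u`. -/
lemma fst_eq_and_panc_of_B_eq_insert (h3 : G.EdgeConn 3) {v u m mv : Fin G.n} {e : G.Edge}
    (hmv : G.IsM v mv) (hm : G.IsMtilde v m) (hu1 : v < u) (hu2 : G.IsM u m)
    (heu : e ∉ G.B u) (hB : G.B v = insert e (G.B u)) :
    G.fst e = mv ∧ G.PAnc mv u := by
  have hu : u ≠ G.root := fun h => absurd (G.root_le v) (h ▸ hu1).not_ge
  obtain ⟨g, hg⟩ := h3.B_nonempty hu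
  have hgv : g ∈ G.B v := hB ▸ Or.inr hg
  have hev : e ∈ G.B v := hB ▸ Or.inl rfl
  have hvu : G.PAnc v u := hgv.2.1.panc_of_lt hg.2.1 hu1
  have hue : ¬ G.Anc u (G.fst e) := fun h =>
    heu ⟨hev.1, h, hev.2.2.trans_anc hvu.1⟩
  have hmvu : G.PAnc mv u := by
    rcases lt_or_ge mv u with hl | hl
    · exact (hmv.anc_fst hgv).panc_of_lt hg.2.1 hl
    · exact absurd ((hg.2.1.anc_of_le (hmv.anc_fst hgv) hl).trans (hmv.anc_fst hev)) hue
  refine ⟨?_, hmvu⟩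
  by_contra hne
  obtain ⟨mv', hmv', -, hm'⟩ := hm
  obtain rfl : mv' = mv := (hmv.2 mv' hmv'.1).antisymm (hmv'.2 mv hmv.1)
  exact hue (hu2.anc.trans
    (hm'.1 _ ⟨e, hev, rfl, hmv.anc_fst hev, fun h => hne h.symm⟩))

/-- If all but at most one child of `M v` has `low1` at least `v`, the edges of `B v` that do
not leave `M v` itself all leave the subtree of one child. -/
lemma exists_child_anc_fst (h3 : G.EdgeConn 3) {v mv : Fin G.n} (hmv : G.IsM v mv)
    (hne : ∃ e ∈ G.B v, G.PAnc mv (G.fst e))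
    (hc2 : (∀ c c', G.IsChild mv c → G.IsChild mv c' → c = c') ∨
        (∀ c y, G.IsC2 mv c → G.IsLow1 c y → v ≤ y)) :
    ∃ c, G.IsChild mv c ∧ ∀ e ∈ G.B v, G.PAnc mv (G.fst e) → G.Anc c (G.fst e) := by
  obtain ⟨e1, he1, hp1⟩ := hne
  obtain ⟨c, hc, hce⟩ := hp1.exists_child
  refine ⟨c, hc, fun e he hp => ?_⟩
  obtain ⟨c', hc', hce'⟩ := hp.exists_child
  suffices h : c = c' from h ▸ hce'
  by_contra hcc
  rcases hc2 with h | h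
  · exact hcc (h c c' hc hc')
  have low_lt : ∀ {d : Fin G.n} {f : G.Edge}, G.IsChild mv d → f ∈ G.B v →
      G.Anc d (G.fst f) → ∃ y, G.IsLow1 d y ∧ y < v := fun {d f} hd hf hdf => by
    obtain ⟨y, hy⟩ := h3.exists_isLow1 hd.1
    exact ⟨y, hy, (hy.2 f (mem_B_of_isChild hmv.anc hd hf hdf)).trans_lt (snd_lt_of_mem_B hf)⟩
  obtain ⟨c2, hC2, hle⟩ := h3.exists_isC2 hc hc' hcc
  have hC2' := hC2
  obtain ⟨_, _, hch2, _⟩ := hC2'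
  obtain ⟨z, hz⟩ := h3.exists_isLow1 hch2.1
  have hvz := h c2 z hC2 hz
  rcases hle with hle | hle
  · obtain ⟨y, hy, hyv⟩ := low_lt hc he1 hce
    exact absurd (hvz.trans (hle z y hz hy)) hyv.not_ge
  · obtain ⟨y, hy, hyv⟩ := low_lt hc' he hce'
    exact absurd (hvz.trans (hle z y hz hy)) hyv.not_ge

end DFSGraph

/-- Lemma 3.6, Case (1): Let `G` be `3`-edge-connected with DFS tree
`T` rooted at `r`, let `v ≠ r` be a vertex with `m = M̃(v)` defined, and suppose `u` is
the minimum vertex in `M⁻¹(m)` strictly greater than `v`. Then there exists a back-edge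
`e` with `B(v) = B(u) ⊔ {e}` if and only if: `b_count(v) = b_count(u) + 1`,
`l2(M(v)) ≥ v`, and either `M(v)` has no `low2` child or `low1(c₂(M(v))) ≥ v`. -/
theorem stmt10 (G : DFSGraph) (h3 : G.EdgeConn 3) (v u m mv : Fin G.n)
    (hv : v ≠ G.root) (hmv : G.IsM v mv) (hm : G.IsMtilde v m)
    (hu1 : v < u) (hu2 : G.IsM u m) (hu3 : ∀ u', v < u' → G.IsM u' m → u ≤ u') :
    (∃ e, G.IsBack e ∧ e ∉ G.B u ∧ G.B v = insert e (G.B u)) ↔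
      (G.bcount v = G.bcount u + 1 ∧
       (∀ y, G.IsL2 mv y → v ≤ y) ∧
       ((∀ c c', G.IsChild mv c → G.IsChild mv c' → c = c') ∨
        (∀ c y, G.IsC2 mv c → G.IsLow1 c y → v ≤ y))) := by
  open DFSGraph in
  constructor
  · rintro ⟨e, -, heu, hB⟩
    obtain ⟨hemv, hmvu⟩ := fst_eq_and_panc_of_B_eq_insert h3 hmv hm hu1 hu2 heu hB
    have eq_e : ∀ f ∈ G.B v, G.fst f = mv → f = e := by
      intro f hf hfm
      rw [hB] at hf
      rcases hf with rfl | hf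
      · rfl
      · exact absurd (hfm ▸ hf.2.1).le hmvu.lt.not_ge
    have mem_u : ∀ f ∈ G.B v, G.fst f ≠ mv → f ∈ G.B u := by
      intro f hf hfm
      rw [hB] at hf
      rcases hf with rfl | hf
      · exact absurd hemv hfm
      · exact hf
    refine ⟨?_, ?_, Or.inr ?_⟩
    · rw [bcount, bcount, hB, Set.ncard_insert_of_notMem heu (Set.toFinite _)]
    · intro y hy
      by_contra! hlt
      rcases hy with ⟨-, rfl⟩ | ⟨f, hf, hfm, hfmin, hy, -, -⟩
      · exact hlt.not_ge hmv.anc.le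
      rcases hy with rfl | ⟨g, hg, hgm, hgf, rfl⟩
      · exact hlt.not_ge hmv.anc.le
      have hgB : g ∈ G.B v := mem_B_of_lt hg (hgm ▸ hmv.anc) hlt
      have hfB : f ∈ G.B v :=
        mem_B_of_lt hf (hfm ▸ hmv.anc) ((hfmin g hg hgm).trans_lt hlt)
      exact hgf ((eq_e g hgB hgm).trans (eq_e f hfB hfm).symm)
    · intro c y hc hy
      by_contra! hlt
      obtain ⟨c1, hc1, hc, hne, -⟩ := hc
      obtain ⟨d, hd, hcd⟩ := hmvu.exists_child
      have eq_d : ∀ c' y', G.IsChild mv c' → G.IsLow1 c' y' → y' < v → c' = d := by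
        rintro c' _ hc' ⟨⟨f, hf, rfl⟩, -⟩ hl
        have hfv := mem_B_of_isChild_of_lt hmv.anc hc' hf hl
        have hfu := mem_u f hfv (hc'.lt.trans_le hf.2.1.le).ne'
        exact hc'.eq_of_anc hd hf.2.1 (hcd.trans hfu.2.1)
      obtain ⟨y1, hy1⟩ := h3.exists_isLow1 hc1.1.1
      exact hne ((eq_d c y hc hy hlt).trans
        (eq_d c1 y1 hc1.1 hy1 ((hc1.2 c hc y1 y hy1 hy).trans_lt hlt)).symm)
  · rintro ⟨hcount, hl2, hc2⟩
    obtain ⟨mv', hmv', hne, hm'⟩ := hm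
    obtain rfl : mv' = mv := (hmv.2 mv' hmv'.1).antisymm (hmv'.2 mv hmv.1)
    obtain ⟨_, e1, he1, rfl, hp1⟩ := hne
    obtain ⟨c, hc, hall⟩ := exists_child_anc_fst h3 hmv ⟨e1, he1, hp1⟩ hc2
    obtain ⟨e, he, hem⟩ : ∃ e ∈ G.B v, G.fst e = mv' := by
      by_contra! hno
      refine absurd (hmv.2 c ?_).le hc.lt.not_ge
      rintro _ ⟨f, hf, rfl⟩
      exact hall f hf ⟨hmv.anc_fst hf, (hno f hf).symm⟩
    have uniq : ∀ f ∈ G.B v, G.fst f = mv' → f = e := by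
      intro f hf hfm
      by_contra hfe
      obtain ⟨y, hy, hle⟩ := exists_isL2_le hf.1 he.1 hfm hem hfe
      rcases hle with hle | hle
      · exact absurd ((hl2 y hy).trans hle) (snd_lt_of_mem_B hf).not_ge
      · exact absurd ((hl2 y hy).trans hle) (snd_lt_of_mem_B he).not_ge
    have hvm : G.Anc v m := hm'.2 v (by rintro _ ⟨f, hf, rfl, -⟩; exact hf.2.1)
    have hvu : G.Anc v u := hvm.anc_of_le hu2.anc hu1.le
    have hsub : G.B v \ {e} ⊆ G.B u := by
      rintro f ⟨hf, hfe⟩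
      have hfp : G.PAnc mv' (G.fst f) :=
        ⟨hmv.anc_fst hf, fun h => hfe (uniq f hf h.symm)⟩
      exact ⟨hf.1, hu2.anc.trans (hm'.1 _ ⟨f, hf, rfl, hfp⟩), hf.2.2.trans_anc hvu⟩
    have hcard := Set.ncard_sdiff_singleton_add_one he (Set.toFinite _)
    have heq : G.B v \ {e} = G.B u := by
      refine Set.eq_of_subset_of_ncard_le hsub ?_ (Set.toFinite _)
      unfold bcount at hcount
      omega
    refine ⟨e, he.1, ?_, ?_⟩
    · rw [← heq]
      exact fun h => h.2 rfl
    · rw [← heq, Set.insert_sdiff_singleton, Set.insert_eq_of_mem he]
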